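/- arXiv:1104.4399 — 2 statements merged into one kernel-verified Lean document; each statement's English description precedes it below -/
import Mathlib

section
/- Let n ≥ 1 and let Q be the quadratic form of signature (n, n) on ℝ^{2n}, Q(x) = x₁² + ⋯ + xₙ² − xₙ₊₁² − ⋯ − x₂ₙ². Fix a vector e ∈ ℝ^{2n} with Q(e) ≠ 0. Then the stabilizer of e in the isometry group of Q acts transitively on the set of n-dimensional totally isotropic subspaces: for any two subspaces W₁, W₂ ⊆ ℝ^{2n} with dim Wᵢ = n and Q|_{Wᵢ} ≡ 0, there exists a linear automorphism g of ℝ^{2n} with Q(g x) = Q(x) for all x, g(e) = e, and g(W₁) = W₂. (This is the homogeneity claim that SO(n, n−1) ⊂ SO(n, n) acts transitively on the flag variety G/P with Levi GL(n, ℝ), used to prove almost-irreducibility of the restriction of degenerate principal series of SO(n, n) to SO(n, n−1).) -/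
/-- A functional that takes the value one somewhere admits an adapted basis. -/
theorem exists_adapted_basis {W : Type*} [AddCommGroup W] [Module ℝ W] [FiniteDimensional ℝ W]
    (m : ℕ) (hW : Module.finrank ℝ W = m + 1) (φ : W →ₗ[ℝ] ℝ) (y : W) (hy : φ y = 1) :
    ∃ b : Module.Basis (Fin (m + 1)) ℝ W, ∀ i, φ (b i) = if i = 0 then 1 else 0 := by
  have hr : LinearMap.range φ = ⊤ := by
    rw [LinearMap.range_eq_top]
    intro c
    exact ⟨c • y, by simp [hy]⟩
  have hk : Module.finrank ℝ (LinearMap.ker φ) = m := by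
    have h := φ.finrank_range_add_finrank_ker
    rw [hr, finrank_top, Module.finrank_self] at h
    omega
  let b0 := Module.finBasisOfFinrankEq ℝ (LinearMap.ker φ) hk
  refine ⟨Module.Basis.mkFinCons y b0 ?_ ?_, ?_⟩
  · intro c x hx h
    have := congrArg φ h
    simpa [hy, LinearMap.mem_ker.mp hx] using this
  · intro z
    exact ⟨-φ z, by simp [hy]⟩
  · intro i
    rw [Module.Basis.coe_mkFinCons]
    refine Fin.cases ?_ (fun j => ?_) i
    · simp [hy]
    · simp [Fin.succ_ne_zero]

/-- Normal form of a maximal isotropic subspace together with an anisotropic vector. -/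
theorem exists_normal_form {V : Type*} [AddCommGroup V] [Module ℝ V] [FiniteDimensional ℝ V]
    (m : ℕ) (hV : Module.finrank ℝ V = 2 * (m + 1)) (B : LinearMap.BilinForm ℝ V)
    (hB : B.Nondegenerate) (hs : ∀ x y, B x y = B y x)
    (W : Submodule ℝ V) (hW : Module.finrank ℝ W = m + 1)
    (hWi : ∀ x ∈ W, ∀ y ∈ W, B x y = 0) (e : V) (he : B e e ≠ 0) :
    ∃ T : ((Fin (m + 1) → ℝ) × (Fin (m + 1) → ℝ)) ≃ₗ[ℝ] V,
      (∀ p, B (T p) (T p) = 2 * ∑ i, p.1 i * p.2 i) ∧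
      (∀ p, T p ∈ W ↔ p.2 = 0) ∧
      T ((B e e / 2) • Pi.single 0 1, Pi.single 0 1) = e := by
  -- a vector of `W` pairing to one with `e`
  have hex : ∃ y : W, B e y = 1 := by
    by_contra hcon
    push Not at hcon
    have hz : ∀ y ∈ W, B y e = 0 := by
      intro y hy
      by_contra hne
      apply hcon ((B y e)⁻¹ • ⟨y, hy⟩)
      simp [hs e y, hne]
    have hle : W ≤ B.orthogonal W := by
      intro x hx
      rw [LinearMap.BilinForm.mem_orthogonal_iff]
      intro y hy
      exact hWi y hy x hx
    have heq : W = B.orthogonal W := by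
      apply Submodule.eq_of_le_of_finrank_eq hle
      rw [LinearMap.BilinForm.finrank_orthogonal hB, hW, hV]
      omega
    have heW : e ∈ W := by
      rw [heq, LinearMap.BilinForm.mem_orthogonal_iff]
      exact hz
    exact he (hWi e heW e heW)
  obtain ⟨y, hy⟩ := hex
  obtain ⟨b, hb⟩ := exists_adapted_basis m hW ((B e).comp W.subtype) y hy
  have hbe : ∀ i, B (b i) e = if i = 0 then 1 else 0 := by
    intro i
    rw [hs, ← hb i]; rfl
  -- first dual system
  have hdual : ∀ i : Fin (m + 1), ∃ f : V, (i = 0 → f = e - (B e e / 2) • (b 0 : V)) ∧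
      ∀ j, B (b j) f = if j = i then 1 else 0 := by
    intro i
    by_cases hi : i = 0
    · subst hi
      refine ⟨_, fun _ => rfl, fun j => ?_⟩
      rw [map_sub, map_smul, hWi _ (b j).2 _ (b 0).2, hbe]
      simp
    · obtain ⟨F, hF⟩ := LinearMap.exists_extend (b.coord i)
      refine ⟨(B.toDual hB).symm F, fun h => absurd h hi, fun j => ?_⟩
      rw [hs, LinearMap.BilinForm.apply_toDual_symm_apply]
      have := LinearMap.congr_fun hF (b j)
      simp only [LinearMap.comp_apply, Submodule.subtype_apply] at this
      rw [this]
      simp [Finsupp.single_apply]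
  choose f' hf0 hf' using hdual
  have hf0 := hf0 0 rfl
  have hf00 : B (f' 0) (f' 0) = 0 := by
    have h1 : B (b 0) (f' 0) = 1 := by simp [hf']
    have h2 : B e (b 0) = 1 := by rw [hs, hbe]; simp
    have h3 : B (f' 0) (f' 0) = B e (f' 0) - (B e e / 2) * B (b 0) (f' 0) := by
      conv_lhs => arg 1; rw [hf0]
      simp
    have h4 : B e (f' 0) = B e e - (B e e / 2) * 1 := by
      conv_lhs => arg 2; rw [hf0]
      simp [h2]
    rw [h3, h4, h1]; ring
  -- corrected, isotropic dual system
  let s : Fin (m + 1) → Fin (m + 1) → ℝ := fun i j =>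
    if j < i then B (f' i) (f' j) else if i = j then B (f' i) (f' i) / 2 else 0
  have hss : ∀ i j, s i j + s j i = B (f' i) (f' j) := by
    intro i j
    rcases lt_trichotomy i j with h | h | h
    · simp [s, h, h.not_gt, h.ne, hs (f' i) (f' j)]
    · subst h; simp [s]
    · simp [s, h, h.not_gt, h.ne]
  have hs0 : ∀ j, s 0 j = 0 := by
    intro j
    simp only [s, Fin.not_lt_zero, if_false, hf00]
    simp
  let f : Fin (m + 1) → V := fun i => f' i - ∑ j, s i j • (b j : V)
  have hcW : ∀ c : Fin (m + 1) → ℝ, ∑ j, c j • (b j : V) ∈ W := fun c =>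
    W.sum_mem fun j _ => W.smul_mem _ (b j).2
  have hbf : ∀ i j, B (b i) (f j) = if i = j then 1 else 0 := by
    intro i j
    simp only [f]
    rw [map_sub, hWi _ (b i).2 _ (hcW _), hf', sub_zero]
  have hbf' : ∀ i (c : Fin (m + 1) → ℝ), B (∑ j, c j • (b j : V)) (f' i) = c i := by
    intro i c
    simp [map_sum, LinearMap.sum_apply, hf']
  have hff : ∀ i j, B (f i) (f j) = 0 := by
    intro i j
    simp only [f]
    rw [map_sub, map_sub, LinearMap.sub_apply, LinearMap.sub_apply, hWi _ (hcW _) _ (hcW _), hbf',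
      hs (f' i) (∑ k, _), hbf', ← hss]
    ring
  have hfe : f 0 = e - (B e e / 2) • (b 0 : V) := by
    simp [f, hs0, hf0]
  let w : Fin (m + 1) → V := fun i => (b i : V)
  let T0 : ((Fin (m + 1) → ℝ) × (Fin (m + 1) → ℝ)) →ₗ[ℝ] V :=
    (Fintype.linearCombination ℝ w).coprod (Fintype.linearCombination ℝ f)
  have hT0 : ∀ p, T0 p = ∑ i, p.1 i • w i + ∑ i, p.2 i • f i := by
    intro p
    simp [T0, Fintype.linearCombination_apply]
  have hwT : ∀ i p, B (w i) (T0 p) = p.2 i := by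
    intro i p
    rw [hT0, map_add, hWi _ (b i).2 _ (hcW _)]
    simp [map_sum, w, hbf]
  have hfT : ∀ i p, B (f i) (T0 p) = p.1 i := by
    intro i p
    rw [hT0, map_add]
    simp [map_sum, w, hff, hs (f i), hbf]
  have hinj : Function.Injective T0 := by
    rw [← LinearMap.ker_eq_bot, LinearMap.ker_eq_bot']
    intro p hp
    ext i
    · rw [← hfT i p, hp]; simp
    · rw [← hwT i p, hp]; simp
  let T := T0.linearEquivOfInjective hinj (by simp [hV]; ring)
  have hT : ∀ p, T p = T0 p := fun p => rfl
  refine ⟨T, ?_, ?_, ?_⟩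
  · intro p
    rw [hT]
    conv_lhs => arg 1; rw [hT0]
    simp only [map_add, map_sum, map_smul, LinearMap.add_apply, LinearMap.sum_apply,
      LinearMap.smul_apply, hwT, hfT, smul_eq_mul]
    rw [two_mul]
    congr 1
    exact Finset.sum_congr rfl fun i _ => mul_comm _ _
  · intro p
    rw [hT]
    constructor
    · intro h
      ext i
      rw [← hwT i p]
      exact hWi _ (b i).2 _ h
    · intro h
      rw [hT0, h]
      simpa using hcW p.1
  · rw [hT, hT0]
    simp [Pi.single_apply, hfe, w]


/-- Let `n ≥ 1` and let `Q` be the quadratic form of signature `(n, n)` on `ℝ^{2n}`,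
`Q x = x₁² + ⋯ + xₙ² − xₙ₊₁² − ⋯ − x₂ₙ²`. Fix `e ∈ ℝ^{2n}` with `Q e ≠ 0`. Then the stabilizer
of `e` in the isometry group of `Q` acts transitively on the set of `n`-dimensional totally
isotropic subspaces. -/
theorem stabilizer_transitive_on_maximal_isotropics_real (n : ℕ) (hn : 1 ≤ n)
    (Q : (Fin (2 * n) → ℝ) → ℝ)
    (hQdef : ∀ x : Fin (2 * n) → ℝ,
      Q x = ∑ i : Fin (2 * n), if (i : ℕ) < n then x i ^ 2 else -(x i ^ 2))
    (e : Fin (2 * n) → ℝ) (he : Q e ≠ 0)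
    (W₁ W₂ : Submodule ℝ (Fin (2 * n) → ℝ))
    (h₁ : Module.finrank ℝ W₁ = n) (h₂ : Module.finrank ℝ W₂ = n)
    (hi₁ : ∀ x ∈ W₁, Q x = 0) (hi₂ : ∀ x ∈ W₂, Q x = 0) :
    ∃ g : (Fin (2 * n) → ℝ) ≃ₗ[ℝ] (Fin (2 * n) → ℝ),
      (∀ x, Q (g x) = Q x) ∧ g e = e ∧ W₁.map g.toLinearMap = W₂ := by
  obtain ⟨m, rfl⟩ : ∃ m, n = m + 1 := ⟨n - 1, by omega⟩
  let d : Fin (2 * (m + 1)) → ℝ := fun i => if (i : ℕ) < m + 1 then 1 else -1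
  let B : LinearMap.BilinForm ℝ (Fin (2 * (m + 1)) → ℝ) := Matrix.toBilin' (Matrix.diagonal d)
  have hBa : ∀ x y, B x y = ∑ i, x i * d i * y i := by
    intro x y
    simp [B, Matrix.toBilin'_apply, Matrix.diagonal_apply]
  have hBQ : ∀ x, B x x = Q x := by
    intro x
    rw [hBa, hQdef]
    refine Finset.sum_congr rfl fun i _ => ?_
    by_cases h : (i : ℕ) < m + 1
    · simp only [d, h, if_true, if_false]; ring
    · simp only [d, h, if_true, if_false]; ring
  have hs : ∀ x y, B x y = B y x := by
    intro x y
    rw [hBa, hBa]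
    exact Finset.sum_congr rfl fun i _ => by ring
  have hB : B.Nondegenerate := by
    apply LinearMap.BilinForm.nondegenerate_toBilin'_of_det_ne_zero'
    rw [Matrix.det_diagonal, Finset.prod_ne_zero_iff]
    intro i _
    by_cases h : (i : ℕ) < m + 1 <;> simp only [d, h, if_true, if_false] <;> norm_num
  have hiso : ∀ W : Submodule ℝ (Fin (2 * (m + 1)) → ℝ), (∀ x ∈ W, Q x = 0) →
      ∀ x ∈ W, ∀ y ∈ W, B x y = 0 := by
    intro W hW x hx y hy
    have h := hW _ (W.add_mem hx hy)
    rw [← hBQ] at h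
    simp only [map_add, LinearMap.add_apply] at h
    rw [hBQ, hBQ, hW x hx, hW y hy, hs y x] at h
    linarith
  have hV : Module.finrank ℝ (Fin (2 * (m + 1)) → ℝ) = 2 * (m + 1) := by simp
  have he' : B e e ≠ 0 := by rwa [hBQ]
  obtain ⟨T₁, hq₁, hw₁, he₁⟩ := exists_normal_form m hV B hB hs W₁ h₁ (hiso W₁ hi₁) e he'
  obtain ⟨T₂, hq₂, hw₂, he₂⟩ := exists_normal_form m hV B hB hs W₂ h₂ (hiso W₂ hi₂) e he'
  refine ⟨T₁.symm.trans T₂, ?_, ?_, ?_⟩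
  · intro x
    rw [← hBQ, ← hBQ, LinearEquiv.trans_apply, hq₂, ← hq₁, LinearEquiv.apply_symm_apply]
  · rw [LinearEquiv.trans_apply]
    conv_lhs => arg 2; arg 2; rw [← he₁]
    rw [LinearEquiv.symm_apply_apply, he₂]
  · ext x
    simp only [Submodule.mem_map, LinearEquiv.coe_coe, LinearEquiv.trans_apply]
    constructor
    · rintro ⟨z, hz, rfl⟩
      rw [hw₂, ← hw₁, LinearEquiv.apply_symm_apply]
      exact hz
    · intro hx
      refine ⟨T₁ (T₂.symm x), ?_, by simp⟩
      rw [hw₁, ← hw₂, LinearEquiv.apply_symm_apply]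
      exact hx
end

section
/- Let n ≥ 1 and let Q be the quadratic form Q(z) = z₁² + ⋯ + z₂ₙ² on ℂ^{2n}. Fix a vector e ∈ ℂ^{2n} with Q(e) ≠ 0. Then the stabilizer of e in the isometry group of Q acts transitively on the set of n-dimensional totally isotropic subspaces: for any two subspaces W₁, W₂ ⊆ ℂ^{2n} with dim Wᵢ = n and Q|_{Wᵢ} ≡ 0, there exists a linear automorphism g of ℂ^{2n} with Q(g x) = Q(x) for all x, g(e) = e, and g(W₁) = W₂. (This is the homogeneity claim that SO(2n−1, ℂ) ⊂ SO(2n, ℂ) acts transitively on the flag variety G/P with Levi GL(n, ℂ), used to prove almost-irreducibility of the restriction of degenerate principal series of SO(2n, ℂ) to SO(2n−1, ℂ).) -/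
open Module in
theorem lagr_split (m n : ℕ) (hm : m = 2 * n) (W : Submodule ℂ (Fin m → ℂ))
    (h : finrank ℂ W = n) (hi : ∀ z ∈ W, z ⬝ᵥ z = 0) :
    ∃ φ : (W × Dual ℂ W) ≃ₗ[ℂ] (Fin m → ℂ),
      (∀ p, φ p ⬝ᵥ φ p = p.2 p.1) ∧ ∀ w : W, φ (w, 0) = w := by
  have hB : ∀ x ∈ W, ∀ y ∈ W, x ⬝ᵥ y = 0 := by
    intro x hx y hy
    have h1 := hi (x + y) (W.add_mem hx hy)
    simp only [add_dotProduct, dotProduct_add, hi x hx, hi y hy, dotProduct_comm y x] at h1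
    linear_combination h1 / 2
  -- the pairing
  let B : (Fin m → ℂ) →ₗ[ℂ] (Fin m → ℂ) →ₗ[ℂ] ℂ := dotProductBilin ℂ ℂ
  have hBd : ∀ x y, B x y = x ⬝ᵥ y := fun x y => rfl
  let r : (Fin m → ℂ) →ₗ[ℂ] Dual ℂ W := (2 : ℂ) • (W.subtype.dualMap ∘ₗ B)
  have hr : ∀ v (w : W), r v w = 2 * (v ⬝ᵥ (w : Fin m → ℂ)) := fun v w => by
    simp [r, hBd]
  have hBsurj : Function.Surjective B := by
    have hinj : Function.Injective B := by
      rw [← LinearMap.ker_eq_bot, LinearMap.ker_eq_bot']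
      intro x hx
      exact dotProduct_eq_zero x (fun y => by rw [← hBd, hx]; rfl)
    exact (LinearMap.injective_iff_surjective_of_finrank_eq_finrank
      (Subspace.dual_finrank_eq).symm).1 hinj
  have hrs : Function.Surjective r := by
    have h1 : Function.Surjective (W.subtype.dualMap ∘ₗ B) := by
      rw [LinearMap.coe_comp]
      exact (LinearMap.dualMap_surjective_of_injective W.injective_subtype).comp hBsurj
    intro f
    obtain ⟨v, hv⟩ := h1 ((1/2 : ℂ) • f)
    refine ⟨v, ?_⟩
    simp only [r, LinearMap.smul_apply, hv, smul_smul]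
    norm_num
  obtain ⟨s, hs⟩ := LinearMap.exists_rightInverse_of_surjective r (LinearMap.range_eq_top.2 hrs)
  have hs' : ∀ f (w : W), 2 * (s f ⬝ᵥ (w : Fin m → ℂ)) = f w := fun f w => by
    rw [← hr, ← LinearMap.comp_apply, hs]; rfl
  let T : Dual ℂ W →ₗ[ℂ] W :=
    (evalEquiv ℂ W).symm.toLinearMap ∘ₗ s.dualMap ∘ₗ B ∘ₗ s
  have hT : ∀ f f' : Dual ℂ W, f' (T f) = s f ⬝ᵥ s f' := by
    intro f f'
    simp [T, hBd]
  let s' : Dual ℂ W →ₗ[ℂ] (Fin m → ℂ) := s - W.subtype ∘ₗ T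
  have hs'd : ∀ f, s' f = s f - (T f : Fin m → ℂ) := fun f => rfl
  have hs'0 : ∀ f, s' f ⬝ᵥ s' f = 0 := by
    intro f
    have h1 := hs' f (T f)
    rw [hT] at h1
    simp only [hs'd, sub_dotProduct, dotProduct_sub, hi _ (T f).2,
      dotProduct_comm (T f : Fin m → ℂ) (s f)]
    linear_combination - h1
  have hs'w : ∀ f (w : W), 2 * (s' f ⬝ᵥ (w : Fin m → ℂ)) = f w := by
    intro f w
    rw [hs'd, sub_dotProduct, hB _ (T f).2 _ w.2, sub_zero, hs']
  let φ : (W × Dual ℂ W) →ₗ[ℂ] (Fin m → ℂ) := W.subtype.coprod s'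
  have hφ : ∀ p, φ p = (p.1 : Fin m → ℂ) + s' p.2 := fun p => rfl
  have hinj : Function.Injective φ := by
    rw [← LinearMap.ker_eq_bot, LinearMap.ker_eq_bot']
    rintro ⟨w, f⟩ h0
    rw [hφ] at h0
    have hf : f = 0 := by
      ext w'
      rw [← hs'w, eq_neg_of_add_eq_zero_right h0, neg_dotProduct, hB _ w.2 _ w'.2]
      simp
    subst hf
    simpa using h0
  have hfr : finrank ℂ (W × Dual ℂ W) = finrank ℂ (Fin m → ℂ) := by
    rw [finrank_prod, Subspace.dual_finrank_eq, h, finrank_fin_fun]; omega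
  refine ⟨LinearEquiv.ofInjectiveOfFinrankEq φ hinj hfr, ?_, ?_⟩
  · intro p
    change φ p ⬝ᵥ φ p = _
    rw [hφ]
    simp only [add_dotProduct, dotProduct_add, hs'0, hi _ p.1.2,
      dotProduct_comm (p.1 : Fin m → ℂ) (s' p.2)]
    linear_combination hs'w p.2 p.1
  · intro w
    change φ (w, 0) = _
    simp [hφ]

open Module in
theorem pair_transitive {V₁ V₂ : Type*} [AddCommGroup V₁] [AddCommGroup V₂] [Module ℂ V₁]
    [Module ℂ V₂] [FiniteDimensional ℂ V₁] [FiniteDimensional ℂ V₂]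
    (hd : finrank ℂ V₁ = finrank ℂ V₂) (w₁ : V₁) (w₂ : V₂) (f₁ : Dual ℂ V₁) (f₂ : Dual ℂ V₂)
    (c : ℂ) (hc : c ≠ 0) (h₁ : f₁ w₁ = c) (h₂ : f₂ w₂ = c) :
    ∃ A : V₁ ≃ₗ[ℂ] V₂, A w₁ = w₂ ∧ ∀ x, f₂ (A x) = f₁ x := by
  have hk : finrank ℂ (LinearMap.ker f₁) = finrank ℂ (LinearMap.ker f₂) := by
    have a₁ := Dual.finrank_ker_add_one_of_ne_zero (f := f₁) (by rintro rfl; exact hc (by simpa using h₁.symm))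
    have a₂ := Dual.finrank_ker_add_one_of_ne_zero (f := f₂) (by rintro rfl; exact hc (by simpa using h₂.symm))
    omega
  let A₀ := LinearEquiv.ofFinrankEq _ _ hk
  let p : V₁ →ₗ[ℂ] LinearMap.ker f₁ :=
    LinearMap.codRestrict _ (LinearMap.id - (c⁻¹ • f₁).smulRight w₁) (by
      intro x
      simp [h₁]
      field_simp
      simp)
  have hp : ∀ x, (p x : V₁) = x - (c⁻¹ * f₁ x) • w₁ := fun x => by simp [p]
  let A : V₁ →ₗ[ℂ] V₂ := (LinearMap.ker f₂).subtype ∘ₗ A₀.toLinearMap ∘ₗ p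
    + (c⁻¹ • f₁).smulRight w₂
  have hA : ∀ x, A x = (A₀ (p x) : V₂) + (c⁻¹ * f₁ x) • w₂ := fun x => by simp [A]
  have hf : ∀ x, f₂ (A x) = f₁ x := by
    intro x
    have := (A₀ (p x)).2
    rw [LinearMap.mem_ker] at this
    rw [hA, map_add, this, map_smul, h₂, smul_eq_mul]
    field_simp
    simp
  have hinj : Function.Injective A := by
    rw [← LinearMap.ker_eq_bot, LinearMap.ker_eq_bot']
    intro x hx
    have h0 : f₁ x = 0 := by rw [← hf, hx, map_zero]
    have h1 := hA x
    rw [hx, h0, mul_zero, zero_smul, add_zero] at h1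
    have h2 : p x = 0 := by
      apply A₀.injective
      rw [map_zero]
      exact Subtype.ext h1.symm
    have h3 := hp x
    rw [h2, h0] at h3
    simpa using h3.symm
  refine ⟨LinearEquiv.ofInjectiveOfFinrankEq A hinj hd, ?_, hf⟩
  change A w₁ = w₂
  have h2 : p w₁ = 0 := by
    apply Subtype.ext
    rw [hp, h₁, inv_mul_cancel₀ hc]; simp
  rw [hA, h2, h₁, inv_mul_cancel₀ hc]; simp

/-- Let `n ≥ 1` and let `Q` be the quadratic form `Q z = z₁² + ⋯ + z₂ₙ²` on `ℂ^{2n}`. Fix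
`e ∈ ℂ^{2n}` with `Q e ≠ 0`. Then the stabilizer of `e` in the isometry group of `Q` acts
transitively on the set of `n`-dimensional totally isotropic subspaces. -/
theorem stabilizer_transitive_on_maximal_isotropics_complex (n : ℕ) (hn : 1 ≤ n)
    (Q : (Fin (2 * n) → ℂ) → ℂ)
    (hQdef : ∀ z : Fin (2 * n) → ℂ, Q z = ∑ i : Fin (2 * n), z i ^ 2)
    (e : Fin (2 * n) → ℂ) (he : Q e ≠ 0)
    (W₁ W₂ : Submodule ℂ (Fin (2 * n) → ℂ))
    (h₁ : Module.finrank ℂ W₁ = n) (h₂ : Module.finrank ℂ W₂ = n)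
    (hi₁ : ∀ z ∈ W₁, Q z = 0) (hi₂ : ∀ z ∈ W₂, Q z = 0) :
    ∃ g : (Fin (2 * n) → ℂ) ≃ₗ[ℂ] (Fin (2 * n) → ℂ),
      (∀ z, Q (g z) = Q z) ∧ g e = e ∧ W₁.map g.toLinearMap = W₂ := by
  have hQ : ∀ z, Q z = z ⬝ᵥ z := fun z => by
    rw [hQdef]; simp [dotProduct, pow_two]
  obtain ⟨φ₁, q₁, r₁⟩ := lagr_split (2 * n) n rfl W₁ h₁ (fun z hz => by rw [← hQ, hi₁ z hz])
  obtain ⟨φ₂, q₂, r₂⟩ := lagr_split (2 * n) n rfl W₂ h₂ (fun z hz => by rw [← hQ, hi₂ z hz])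
  obtain ⟨A, hAw, hAf⟩ := pair_transitive (h₁.trans h₂.symm) (φ₁.symm e).1 (φ₂.symm e).1
    (φ₁.symm e).2 (φ₂.symm e).2 (Q e) he
    (by rw [← q₁, LinearEquiv.apply_symm_apply, hQ])
    (by rw [← q₂, LinearEquiv.apply_symm_apply, hQ])
  let g := φ₁.symm ≪≫ₗ (A.prodCongr A.dualMap.symm) ≪≫ₗ φ₂
  have hg : ∀ z, g z = φ₂ (A (φ₁.symm z).1, A.dualMap.symm (φ₁.symm z).2) := fun z => rfl
  have hd : ∀ (f : Module.Dual ℂ W₁) x, A.dualMap.symm f x = f (A.symm x) := fun f x => rfl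
  have hgW : ∀ w : W₁, g w = A w := by
    intro w
    rw [hg, ← r₁ w, LinearEquiv.symm_apply_apply, map_zero, r₂]
  refine ⟨g, ?_, ?_, ?_⟩
  · intro z
    rw [hQ, hQ, hg, q₂]
    simp only [hd, LinearEquiv.symm_apply_apply]
    rw [← q₁, LinearEquiv.apply_symm_apply]
  · rw [hg, hAw]
    have : A.dualMap.symm (φ₁.symm e).2 = (φ₂.symm e).2 := by
      ext x
      rw [hd, ← hAf, LinearEquiv.apply_symm_apply]
    rw [this]
    exact φ₂.apply_symm_apply e
  · ext y
    constructor
    · rintro ⟨x, hx, rfl⟩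
      have := hgW ⟨x, hx⟩
      change g x ∈ W₂
      rw [this]
      exact (A ⟨x, hx⟩).2
    · intro hy
      refine ⟨A.symm ⟨y, hy⟩, (A.symm ⟨y, hy⟩).2, ?_⟩
      change g _ = y
      rw [hgW, LinearEquiv.apply_symm_apply]
end
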